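/- arXiv:1407.2479 — 2 statements merged into one kernel-verified Lean document; each statement's English description precedes it below -/
import Mathlib

section
/- For every ε ∈ (0, 1/6), every (possibly randomized) m-sample pricing strategy that is (1 − ε)-approximate for every regular value distribution satisfies m ≥ (1 − 6ε)² / (486·ε³). -/
open MeasureTheory Set

/-- A value distribution on `[0,∞)` with CDF `F`, density `f` (w.r.t. Lebesgue measure),
whose support is an interval contained in `[0,∞)`. -/
structure ValueDist where
  μ : Measure ℝ
  isProb : IsProbabilityMeasure μ
  f : ℝ → ℝ
  f_nonneg : ∀ x, 0 ≤ f x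
  f_meas : Measurable f
  density_eq : μ = volume.withDensity fun x => ENNReal.ofReal (f x)
  supp : Set ℝ
  supp_subset : supp ⊆ Ici 0
  supp_conn : supp.OrdConnected
  f_pos : ∀ x ∈ supp, 0 < f x
  f_zero : ∀ x ∉ supp, f x = 0

/-- The CDF of a value distribution. -/
noncomputable def ValueDist.F (D : ValueDist) (x : ℝ) : ℝ := (D.μ (Iic x)).toReal

/-- The virtual value function `φ(v) = v - (1 - F v) / f v`. -/
noncomputable def ValueDist.phi (D : ValueDist) (x : ℝ) : ℝ := x - (1 - D.F x) / D.f x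

/-- Monotone hazard rate: the virtual value satisfies `dφ/dv ≥ 1` throughout the support. -/
def ValueDist.IsMHR (D : ValueDist) : Prop :=
  ∀ x ∈ D.supp, ∃ d : ℝ, 1 ≤ d ∧ HasDerivWithinAt D.phi d D.supp x

/-- Regularity: the virtual value function is nondecreasing on the support. -/
def ValueDist.IsRegular (D : ValueDist) : Prop :=
  ∀ x ∈ D.supp, ∀ y ∈ D.supp, x ≤ y → D.phi x ≤ D.phi y

/-- The expected revenue of a randomized `m`-sample pricing strategy `strat` (whose
internal randomness is drawn from the probability space `(Ω, P)`) against the value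
distribution `μ`. -/
noncomputable def expRevenue {m : ℕ} {Ω : Type} [MeasurableSpace Ω]
    (μ : Measure ℝ) (P : Measure Ω) (strat : (Fin m → ℝ) → Ω → ℝ) : ℝ :=
  ∫ x, strat x.1 x.2 * (1 - (μ (Iic (strat x.1 x.2))).toReal)
    ∂((Measure.pi fun _ : Fin m => μ).prod P)


lemma pi_withDensity_aux {m : ℕ} (μ1 μ2 : Measure ℝ) [IsProbabilityMeasure μ1]
    [IsProbabilityMeasure μ2] (ρ : ℝ → ℝ) (hρm : Measurable ρ) (hρ0 : ∀ x, 0 ≤ ρ x)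
    (C : ℝ) (hC : ∀ x, ρ x ≤ C)
    (h12 : μ2 = μ1.withDensity fun x => ENNReal.ofReal (ρ x)) :
    (Measure.pi fun _ : Fin m => μ2) =
      (Measure.pi fun _ : Fin m => μ1).withDensity
        fun x => ENNReal.ofReal (∏ i, ρ (x i)) := by
  apply Measure.pi_eq
  intro s hs
  have hint : ∀ (ν : Measure ℝ) [IsFiniteMeasure ν], Integrable ρ ν := fun ν _ =>
    Integrable.of_bound hρm.aestronglyMeasurable C
      (Filter.Eventually.of_forall fun x => by
        rw [Real.norm_eq_abs, abs_of_nonneg (hρ0 x)]; exact hC x)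
  rw [withDensity_apply _ (MeasurableSet.univ_pi hs), Measure.restrict_pi_pi,
    ← ofReal_integral_eq_lintegral_ofReal
      (Integrable.fintype_prod_dep (fun i => hint _))
      (Filter.Eventually.of_forall fun x => Finset.prod_nonneg fun i _ => hρ0 _),
    integral_fintype_prod_eq_prod (fun _ => ρ),
    ENNReal.ofReal_prod_of_nonneg (fun i _ => integral_nonneg hρ0)]
  refine Finset.prod_congr rfl fun i _ => ?_
  rw [h12, withDensity_apply _ (hs i), ofReal_integral_eq_lintegral_ofReal (hint _)
    (Filter.Eventually.of_forall hρ0)]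

lemma info_aux {m : ℕ} {Ω : Type} [MeasurableSpace Ω] (P : Measure Ω) [IsProbabilityMeasure P]
    (μ1 μ2 : Measure ℝ) [IsProbabilityMeasure μ1]
    [IsProbabilityMeasure μ2] (ρ : ℝ → ℝ) (hρm : Measurable ρ) (hρ0 : ∀ x, 0 ≤ ρ x)
    (C : ℝ) (hC : ∀ x, ρ x ≤ C)
    (h12 : μ2 = μ1.withDensity fun x => ENNReal.ofReal (ρ x))
    (χ : ℝ) (hχ : ∫ x, (ρ x - 1) ^ 2 ∂μ1 ≤ χ)
    (h : (Fin m → ℝ) × Ω → ℝ) (hm : Measurable h) (ε : ℝ) (hε : 0 < ε)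
    (h0 : ∀ x, 0 ≤ h x) (h1 : ∀ x, h x ≤ 3 * ε)
    (hE1 : ∫ x, h x ∂((Measure.pi fun _ : Fin m => μ1).prod P) ≤ ε)
    (hE2 : 2 * ε ≤ ∫ x, h x ∂((Measure.pi fun _ : Fin m => μ2).prod P)) :
    13 / 9 ≤ (1 + χ) ^ m := by
  set ν := (Measure.pi fun _ : Fin m => μ1).prod P with hν
  set L : (Fin m → ℝ) × Ω → ℝ := fun x => ∏ i, ρ (x.1 i) with hL
  have hLm : Measurable L := by
    apply Finset.measurable_prod
    intro i _
    exact hρm.comp ((measurable_pi_apply i).comp measurable_fst)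
  have hL0 : ∀ x, 0 ≤ L x := fun x => Finset.prod_nonneg fun i _ => hρ0 _
  have hLC : ∀ x, L x ≤ C ^ m := fun x => by
    have : L x ≤ ∏ i : Fin m, C := Finset.prod_le_prod (fun i _ => hρ0 _) (fun i _ => hC _)
    simpa using this
  have hbd : ∀ (g : (Fin m → ℝ) × Ω → ℝ) (K : ℝ), Measurable g → (∀ x, |g x| ≤ K) →
      Integrable g ν := fun g K hg hK =>
    Integrable.of_bound hg.aestronglyMeasurable K (Filter.Eventually.of_forall hK)
  have habsL : ∀ x, |L x| ≤ C ^ m := fun x => by rw [abs_of_nonneg (hL0 x)]; exact hLC x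
  have habsh : ∀ x, |h x| ≤ 3 * ε := fun x => by rw [abs_of_nonneg (h0 x)]; exact h1 x
  have iL : Integrable L ν := hbd L _ hLm habsL
  have ih : Integrable h ν := hbd h _ hm habsh
  have iL2 : Integrable (fun x => L x ^ 2) ν := hbd _ ((C ^ m) ^ 2) (hLm.pow_const 2) fun x => by
    rw [abs_pow]; exact pow_le_pow_left₀ (abs_nonneg _) (habsL x) 2
  have iLh : Integrable (fun x => L x * h x) ν := hbd _ (C ^ m * (3 * ε)) (hLm.mul hm) fun x => by
    rw [abs_mul]
    exact mul_le_mul (habsL x) (habsh x) (abs_nonneg _) ((abs_nonneg _).trans (habsL x))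
  -- change of measure
  have hprod : (Measure.pi fun _ : Fin m => μ2).prod P
      = ν.withDensity fun x => ENNReal.ofReal (L x) := by
    rw [pi_withDensity_aux μ1 μ2 ρ hρm hρ0 C hC h12, prod_withDensity_left]
    apply Measurable.ennreal_ofReal
    apply Finset.measurable_prod
    intro i _
    exact hρm.comp (measurable_pi_apply i)
  have hchg : ∀ g : (Fin m → ℝ) × Ω → ℝ,
      ∫ x, g x ∂((Measure.pi fun _ : Fin m => μ2).prod P) = ∫ x, L x * g x ∂ν := by
    intro g
    rw [hprod, integral_withDensity_eq_integral_toReal_smul hLm.ennreal_ofReal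
      (Filter.Eventually.of_forall fun x => ENNReal.ofReal_lt_top)]
    simp only [ENNReal.toReal_ofReal (hL0 _), smul_eq_mul]
  rw [hchg] at hE2
  have hLone : ∫ x, L x ∂ν = 1 := by
    have := hchg (fun _ => 1)
    simp at this
    exact this.symm
  -- second moment
  have iρ : Integrable ρ μ1 := Integrable.of_bound hρm.aestronglyMeasurable C
      (Filter.Eventually.of_forall fun x => by
        rw [Real.norm_eq_abs, abs_of_nonneg (hρ0 x)]; exact hC x)
  have iρ2 : Integrable (fun x => ρ x ^ 2) μ1 :=
    Integrable.of_bound (hρm.pow_const 2).aestronglyMeasurable (C ^ 2)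
      (Filter.Eventually.of_forall fun x => by
        rw [Real.norm_eq_abs, abs_of_nonneg (by positivity)]
        exact pow_le_pow_left₀ (hρ0 x) (hC x) 2)
  have hρone : ∫ x, ρ x ∂μ1 = 1 := by
    have h3 : ∫ x, (1:ℝ) ∂μ2 = ∫ x, ρ x ∂μ1 := by
      rw [h12, integral_withDensity_eq_integral_toReal_smul hρm.ennreal_ofReal
        (Filter.Eventually.of_forall fun x => ENNReal.ofReal_lt_top)]
      simp only [ENNReal.toReal_ofReal (hρ0 _), smul_eq_mul, mul_one]
    simp at h3
    exact h3.symm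
  have hρ2 : ∫ x, ρ x ^ 2 ∂μ1 ≤ 1 + χ := by
    have h4 : ∫ x, (ρ x - 1) ^ 2 ∂μ1 = ∫ x, ρ x ^ 2 ∂μ1 - 2 * ∫ x, ρ x ∂μ1 + 1 := by
      have : (fun x => (ρ x - 1) ^ 2) = fun x => (ρ x ^ 2 - 2 * ρ x) + 1 := by
        funext x; ring
      rw [this, integral_add (by fun_prop) (by fun_prop),
        integral_sub iρ2 (iρ.const_mul 2), integral_const_mul]
      simp
    rw [hρone] at h4
    linarith
  have hL2 : ∫ x, L x ^ 2 ∂ν ≤ (1 + χ) ^ m := by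
    have h5 : ∫ x, L x ^ 2 ∂ν = (∫ x, ρ x ^ 2 ∂μ1) ^ m := by
      have h6 := integral_fun_fst (μ := Measure.pi fun _ : Fin m => μ1) (ν := P)
        (fun y : Fin m → ℝ => (∏ i, ρ (y i)) ^ 2)
      simp only [hL, hν]
      rw [h6]
      simp only [← Finset.prod_pow]
      rw [integral_fintype_prod_eq_pow (fun x => ρ x ^ 2)]
      simp
    rw [h5]
    exact pow_le_pow_left₀ (integral_nonneg fun x => by positivity) hρ2 m
  -- AM-GM
  have hpt : ∀ x, L x * h x ≤ h x + 3 * ε / 2 * L x - 3 * ε / 2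
      + 9 * ε / 8 * (L x ^ 2 - 2 * L x + 1) + ε / 2 := by
    intro x
    have hk : (h x - 3 * ε / 2) ^ 2 ≤ (3 * ε / 2) ^ 2 := by nlinarith [h0 x, h1 x]
    have hsq := sq_nonneg (9 * ε / 4 * (L x - 1) - (h x - 3 * ε / 2))
    have : 9 * ε / 2 * ((L x - 1) * (h x - 3 * ε / 2)) ≤
       9 * ε / 2 * (9 * ε / 8 * (L x - 1) ^ 2 + ε / 2) := by nlinarith
    have := le_of_mul_le_mul_left this (by positivity)
    linarith
  have hmono := integral_mono (μ := ν) iLh (g := fun x => h x + 3 * ε / 2 * L x - 3 * ε / 2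
      + 9 * ε / 8 * (L x ^ 2 - 2 * L x + 1) + ε / 2) (by fun_prop) hpt
  have hr : ∫ x, (h x + 3 * ε / 2 * L x - 3 * ε / 2
      + 9 * ε / 8 * (L x ^ 2 - 2 * L x + 1) + ε / 2) ∂ν
      = ∫ x, h x ∂ν + 3 * ε / 2 * ∫ x, L x ∂ν - 3 * ε / 2
       + 9 * ε / 8 * (∫ x, L x ^ 2 ∂ν - 2 * ∫ x, L x ∂ν + 1) + ε / 2 := by
    rw [integral_add (by fun_prop) (by fun_prop), integral_add (by fun_prop) (by fun_prop),
      integral_sub (by fun_prop) (by fun_prop), integral_add (by fun_prop) (by fun_prop),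
      integral_const_mul, integral_const_mul,
      integral_add (by fun_prop) (by fun_prop), integral_sub (by fun_prop) (by fun_prop),
      integral_const_mul]
    simp
  rw [hr, hLone] at hmono
  have : 9 * ε / 8 * (13 / 9) ≤ 9 * ε / 8 * (1 + χ) ^ m := by
    have := mul_le_mul_of_nonneg_left hL2 (show 0 ≤ 9 * ε / 8 by positivity)
    linarith
  exact le_of_mul_le_mul_left this (by positivity)

lemma tail_aux (a c x : ℝ) (hx : a < x) (hc : 0 ≤ c) :
    ∫⁻ v in Ioi x, ENNReal.ofReal (c / (v - a) ^ 2) = ENNReal.ofReal (c / (x - a)) := by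
  have hd : ∀ v ∈ Ici x, HasDerivAt (fun v => -(c / (v - a))) (c / (v - a) ^ 2) v := by
    intro v hv
    have hne : v - a ≠ 0 := by
      have : x ≤ v := hv
      linarith
    have := (((hasDerivAt_id v).sub_const a).fun_inv hne).const_mul (-c)
    have e1 : (fun v => -(c / (v - a))) = fun y => -c * (id y - a)⁻¹ := by
      funext y; simp [div_eq_mul_inv]
    have e2 : c / (v - a) ^ 2 = -c * (-1 / (id v - a) ^ 2) := by
      simp only [id]; ring
    rw [e1, e2]
    exact this
  have hpos : ∀ v ∈ Ioi x, 0 ≤ c / (v - a) ^ 2 := fun v _ => by positivity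
  have hlim : Filter.Tendsto (fun v => -(c / (v - a))) Filter.atTop (nhds 0) := by
    have : Filter.Tendsto (fun v : ℝ => v - a) Filter.atTop Filter.atTop :=
      Filter.tendsto_atTop_add_const_right _ (-a) Filter.tendsto_id
    have := (this.const_div_atTop c).neg
    simpa using this
  have hi := integrableOn_Ioi_deriv_of_nonneg' hd hpos hlim
  have he := integral_Ioi_of_hasDerivAt_of_nonneg' hd hpos hlim
  rw [← ofReal_integral_eq_lintegral_ofReal hi
    ((ae_restrict_iff' measurableSet_Ioi).2 (Filter.Eventually.of_forall hpos)), he]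
  simp

noncomputable def dens1 (v : ℝ) : ℝ := if 0 ≤ v then 1 / (v - (-1)) ^ 2 else 0

noncomputable def rhoS (s v : ℝ) : ℝ := if v < s / (1 - s) then 1 else (s * (1 + v) / (v - s)) ^ 2

lemma dens1_nonneg (v : ℝ) : 0 ≤ dens1 v := by unfold dens1; split_ifs <;> positivity

lemma dens1_meas : Measurable dens1 :=
  Measurable.ite measurableSet_Ici (by fun_prop) measurable_const

lemma rhoS_nonneg (s v : ℝ) : 0 ≤ rhoS s v := by unfold rhoS; split_ifs <;> positivity

lemma rhoS_meas (s : ℝ) : Measurable (rhoS s) :=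
  Measurable.ite measurableSet_Iio measurable_const (by fun_prop)

noncomputable def mu1 : Measure ℝ := volume.withDensity fun x => ENNReal.ofReal (dens1 x)

noncomputable def mu2 (s : ℝ) : Measure ℝ :=
  volume.withDensity fun x => ENNReal.ofReal (dens1 x * rhoS s x)

lemma mu2_eq (s : ℝ) : mu2 s = mu1.withDensity fun x => ENNReal.ofReal (rhoS s x) := by
  unfold mu2 mu1
  rw [← withDensity_mul _ dens1_meas.ennreal_ofReal (rhoS_meas s).ennreal_ofReal]
  congr 1
  funext x
  simp [ENNReal.ofReal_mul (dens1_nonneg x)]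

lemma mu1_Ioi (x : ℝ) (hx : 0 ≤ x) : mu1 (Ioi x) = ENNReal.ofReal (1 / (1 + x)) := by
  unfold mu1
  rw [withDensity_apply _ measurableSet_Ioi]
  have : ∫⁻ v in Ioi x, ENNReal.ofReal (dens1 v)
      = ∫⁻ v in Ioi x, ENNReal.ofReal (1 / (v - (-1)) ^ 2) := by
    apply setLIntegral_congr_fun measurableSet_Ioi
    intro v hv
    have : 0 ≤ v := hx.trans (le_of_lt hv)
    simp [dens1, this]
  rw [this, tail_aux _ _ _ (by linarith) zero_le_one]
  congr 2; ring

lemma mu1_univ : mu1 univ = 1 := by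
  have h0 : mu1 (Iic 0) = 0 := by
    unfold mu1
    rw [withDensity_apply _ measurableSet_Iic, ← setLIntegral_congr Iio_ae_eq_Iic]
    rw [setLIntegral_congr_fun (g := fun _ => 0) measurableSet_Iio]
    · simp
    · intro v hv
      have : ¬ (0 ≤ v) := not_le.2 hv
      simp [dens1, this]
  have h1 := mu1_Ioi 0 le_rfl
  rw [← Iic_union_Ioi (a := (0:ℝ)), measure_union (by simp) measurableSet_Ioi, h0, h1]
  simp

instance : IsProbabilityMeasure mu1 := ⟨mu1_univ⟩

lemma t_facts {s : ℝ} (hs : 0 < s) (hs1 : s < 1) : 0 < s / (1 - s) ∧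
    1 / (1 + s / (1 - s)) = 1 - s ∧
    ∀ v, s / (1 - s) ≤ v → s < v ∧ s ^ 2 * (1 + v) ≤ v - s := by
  have h1 : 0 < 1 - s := by linarith
  refine ⟨by positivity, by field_simp; ring, fun v hv => ?_⟩
  rw [div_le_iff₀ h1] at hv
  constructor <;> nlinarith

lemma mu2_Ioi_ge {s : ℝ} (hs : 0 < s) (hs1 : s < 1) (x : ℝ) (hx : s / (1 - s) ≤ x) :
    mu2 s (Ioi x) = ENNReal.ofReal (s ^ 2 / (x - s)) := by
  obtain ⟨ht, -, hv⟩ := t_facts hs hs1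
  unfold mu2
  rw [withDensity_apply _ measurableSet_Ioi, ← tail_aux s (s ^ 2) x (hv x hx).1 (by positivity)]
  apply setLIntegral_congr_fun measurableSet_Ioi
  intro v hvx
  have h1 : s / (1 - s) ≤ v := hx.trans (le_of_lt hvx)
  have h2 := (hv v h1).1
  have h0 : 0 ≤ v := ht.le.trans h1
  have h3 : v - s ≠ 0 := by linarith
  have h4 : 1 + v ≠ 0 := by linarith
  simp only [dens1, rhoS, h0, not_lt.2 h1, if_true, if_false]
  congr 1
  rw [show v - -1 = 1 + v by ring]
  field_simp

lemma mu2_Ioi_le {s : ℝ} (hs : 0 < s) (hs1 : s < 1) (x : ℝ) (hx : x ≤ s / (1 - s)) :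
    mu2 s (Ioi x) = mu1 (Ioi x) := by
  obtain ⟨ht, ht1, -⟩ := t_facts hs hs1
  rw [← Ioc_union_Ioi_eq_Ioi hx, measure_union (by simp) measurableSet_Ioi,
    measure_union (by simp) measurableSet_Ioi]
  congr 1
  · unfold mu1 mu2
    rw [withDensity_apply _ measurableSet_Ioc, withDensity_apply _ measurableSet_Ioc,
      ← setLIntegral_congr Ioo_ae_eq_Ioc, ← setLIntegral_congr Ioo_ae_eq_Ioc]
    apply setLIntegral_congr_fun measurableSet_Ioo
    intro v hv
    simp [rhoS, hv.2]
  · rw [mu2_Ioi_ge hs hs1 _ le_rfl, mu1_Ioi _ ht.le, ht1]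
    congr 1
    have h1 : 0 < 1 - s := by linarith
    have : s / (1 - s) - s = s ^ 2 / (1 - s) := by field_simp; ring
    rw [this]; field_simp

lemma mu2_prob {s : ℝ} (hs : 0 < s) (hs1 : s < 1) : IsProbabilityMeasure (mu2 s) := by
  obtain ⟨ht, ht1, -⟩ := t_facts hs hs1
  constructor
  have h0 : mu2 s (Iic 0) = mu1 (Iic 0) := by
    unfold mu1 mu2
    rw [withDensity_apply _ measurableSet_Iic, withDensity_apply _ measurableSet_Iic]
    apply setLIntegral_congr_fun measurableSet_Iic
    intro v hv
    have : v < s / (1 - s) := lt_of_le_of_lt hv ht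
    simp [rhoS, this]
  rw [← Iic_union_Ioi (a := (0:ℝ)), measure_union (by simp) measurableSet_Ioi, h0,
    mu2_Ioi_le hs hs1 0 ht.le, ← measure_union (by simp) measurableSet_Ioi, Iic_union_Ioi, mu1_univ]

lemma one_sub_cdf (μ : Measure ℝ) [IsProbabilityMeasure μ] (x : ℝ) :
    1 - (μ (Iic x)).toReal = (μ (Ioi x)).toReal := by
  have := probReal_compl_eq_one_sub (μ := μ) (measurableSet_Iic (a := x))
  rw [compl_Iic] at this
  exact this.symm

noncomputable def D1 : ValueDist where
  μ := mu1
  isProb := inferInstance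
  f := dens1
  f_nonneg := dens1_nonneg
  f_meas := dens1_meas
  density_eq := rfl
  supp := Ici 0
  supp_subset := subset_rfl
  supp_conn := ordConnected_Ici
  f_pos := by
    intro x hx
    have : (0:ℝ) ≤ x := hx
    simp only [dens1, this, if_true]
    have : 0 < x - -1 := by linarith
    positivity
  f_zero := by
    intro x hx
    have : ¬ (0:ℝ) ≤ x := hx
    simp [dens1, this]

noncomputable def D2 {s : ℝ} (hs : 0 < s) (hs1 : s < 1) : ValueDist where
  μ := mu2 s
  isProb := mu2_prob hs hs1
  f := fun x => dens1 x * rhoS s x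
  f_nonneg := fun x => mul_nonneg (dens1_nonneg x) (rhoS_nonneg s x)
  f_meas := dens1_meas.mul (rhoS_meas s)
  density_eq := rfl
  supp := Ici 0
  supp_subset := subset_rfl
  supp_conn := ordConnected_Ici
  f_pos := by
    intro x hx
    refine mul_pos (D1.f_pos x hx) ?_
    unfold rhoS
    split_ifs with h
    · exact one_pos
    · have := ((t_facts hs hs1).2.2 x (not_lt.1 h)).1
      have h1 : 0 < x - s := by linarith
      have h2 : 0 < 1 + x := by linarith
      positivity
  f_zero := by
    intro x hx
    rw [show dens1 x = 0 from D1.f_zero x hx, zero_mul]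

lemma D1_reg : D1.IsRegular := by
  have key : ∀ x ∈ D1.supp, D1.phi x = -1 := by
    intro x hx
    have hx0 : (0:ℝ) ≤ x := hx
    have h1 : 1 - D1.F x = 1 / (1 + x) := by
      have : 1 - D1.F x = (mu1 (Ioi x)).toReal := one_sub_cdf mu1 x
      rw [this, mu1_Ioi x hx0, ENNReal.toReal_ofReal (by positivity)]
    have h2 : D1.f x = 1 / (1 + x) ^ 2 := by
      simp only [D1, dens1, hx0, if_true]
      congr 2; ring
    unfold ValueDist.phi
    rw [h1, h2]
    field_simp
    ring
  intro x hx y hy _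
  rw [key x hx, key y hy]

lemma D2_reg {s : ℝ} (hs : 0 < s) (hs1 : s < 1) : (D2 hs hs1).IsRegular := by
  have := mu2_prob hs hs1
  have hF : ∀ x, 1 - (D2 hs hs1).F x = (mu2 s (Ioi x)).toReal := fun x => one_sub_cdf (mu2 s) x
  have key1 : ∀ x, 0 ≤ x → x < s / (1 - s) → (D2 hs hs1).phi x = -1 := by
    intro x hx hxt
    have h2 : (D2 hs hs1).f x = 1 / (1 + x) ^ 2 := by
      simp only [D2, dens1, rhoS, hx, hxt, if_true, mul_one]
      congr 2; ring
    unfold ValueDist.phi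
    rw [hF, h2, mu2_Ioi_le hs hs1 x hxt.le, mu1_Ioi x hx, ENNReal.toReal_ofReal (by positivity)]
    field_simp
    ring
  have key2 : ∀ x, 0 ≤ x → s / (1 - s) ≤ x → (D2 hs hs1).phi x = s := by
    intro x hx hxt
    have h3 := ((t_facts hs hs1).2.2 x hxt).1
    have h4 : 0 < x - s := by linarith
    have h2 : (D2 hs hs1).f x = s ^ 2 / (x - s) ^ 2 := by
      simp only [D2, dens1, rhoS, hx, not_lt.2 hxt, if_true, if_false]
      rw [show x - -1 = 1 + x by ring]
      field_simp
    unfold ValueDist.phi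
    rw [hF, h2, mu2_Ioi_ge hs hs1 x hxt, ENNReal.toReal_ofReal (by positivity)]
    field_simp
    ring
  intro x hx y hy hxy
  rcases lt_or_ge x (s / (1 - s)) with h | h
  · rw [key1 x hx h]
    rcases lt_or_ge y (s / (1 - s)) with h' | h'
    · rw [key1 y hy h']
    · rw [key2 y hy h']; linarith
  · rw [key2 x hx h, key2 y hy (h.trans hxy)]

lemma rhoS_le {s : ℝ} (hs : 0 < s) (hs1 : s < 1) (v : ℝ) : rhoS s v ≤ 1 / s ^ 2 ∧
    (s / (1 - s) ≤ v → s ^ 2 ≤ rhoS s v) := by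
  unfold rhoS
  split_ifs with h
  · refine ⟨?_, fun h' => absurd h (not_lt.2 h')⟩
    rw [le_div_iff₀ (by positivity)]
    nlinarith
  · obtain ⟨h1, h2⟩ := (t_facts hs hs1).2.2 v (not_lt.1 h)
    have h3 : 0 < v - s := by linarith
    have h4 : 0 < 1 + v := by linarith
    constructor
    · rw [show 1 / s ^ 2 = (1 / s) ^ 2 by field_simp]
      apply pow_le_pow_left₀ (by positivity)
      rw [div_le_div_iff₀ h3 hs]
      nlinarith
    · intro _
      apply pow_le_pow_left₀ hs.le
      rw [le_div_iff₀ h3]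
      nlinarith

lemma chi_aux {s : ℝ} (hs : 0 < s) (hs1 : s < 1) :
    ∫ x, (rhoS s x - 1) ^ 2 ∂mu1 ≤ (1 - s) * (2 * (1 - s) / s ^ 2) ^ 2 := by
  obtain ⟨ht, ht1, -⟩ := t_facts hs hs1
  have hpt : ∀ x, (rhoS s x - 1) ^ 2 ≤
      (Ici (s / (1 - s))).indicator (fun _ => (2 * (1 - s) / s ^ 2) ^ 2) x := by
    intro x
    by_cases hx : s / (1 - s) ≤ x
    · rw [indicator_of_mem (show x ∈ Ici (s / (1 - s)) from hx)]
      obtain ⟨h1, h2⟩ := rhoS_le hs hs1 x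
      have h2 := h2 hx
      have h5 : 1 / s ^ 2 - 1 ≤ 2 * (1 - s) / s ^ 2 := by
        rw [div_sub_one (by positivity)]
        gcongr
        nlinarith
      have h6 : 1 - s ^ 2 ≤ 2 * (1 - s) / s ^ 2 := by
        have h7 : s ^ 2 ≤ 1 := by nlinarith
        have h8 : 2 * (1 - s) ≤ 2 * (1 - s) / s ^ 2 := by
          rw [le_div_iff₀ (by positivity)]
          nlinarith
        nlinarith
      apply sq_le_sq'
      · linarith
      · linarith
    · rw [indicator_of_notMem (show x ∉ Ici (s / (1 - s)) from hx)]
      simp [rhoS, not_le.1 hx]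
  have h := integral_mono_of_nonneg (μ := mu1)
    (Filter.Eventually.of_forall fun x => sq_nonneg (rhoS s x - 1))
    ((integrable_const _).indicator measurableSet_Ici) (Filter.Eventually.of_forall hpt)
  refine h.trans (le_of_eq ?_)
  have hm : mu1.real (Ici (s / (1 - s))) = 1 - s := by
    have h1 : mu1 (Ici (s / (1 - s))) = mu1 (Ioi (s / (1 - s))) := by
      unfold mu1
      rw [withDensity_apply _ measurableSet_Ioi, withDensity_apply _ measurableSet_Ici,
        setLIntegral_congr Ioi_ae_eq_Ici]
    rw [measureReal_def, h1, mu1_Ioi _ ht.le, ht1, ENNReal.toReal_ofReal (by linarith)]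
  rw [integral_indicator_const _ measurableSet_Ici, hm, smul_eq_mul]

noncomputable def hS (s p : ℝ) : ℝ := if p ≤ s / (1 - s) then 1 - s else 1 / (1 + p)

lemma hS_meas (s : ℝ) : Measurable (hS s) :=
  Measurable.ite measurableSet_Iic measurable_const (by fun_prop)

lemma hS_bd {s : ℝ} (hs : 0 < s) (hs1 : s < 1) (p : ℝ) : 0 ≤ hS s p ∧ hS s p ≤ 1 - s := by
  obtain ⟨ht, ht1, -⟩ := t_facts hs hs1
  unfold hS
  split_ifs with h
  · constructor <;> linarith
  · have h1 := not_le.1 h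
    have : 0 < p := ht.trans h1
    refine ⟨by positivity, ?_⟩
    rw [← ht1]
    gcongr

lemma rev1_le {s : ℝ} (hs : 0 < s) (hs1 : s < 1) (p : ℝ) :
    p * (1 - (mu1 (Iic p)).toReal) ≤ 1 - hS s p := by
  obtain ⟨ht, ht1, -⟩ := t_facts hs hs1
  rw [one_sub_cdf]
  rcases lt_or_ge p 0 with hp | hp
  · have := mul_nonneg (neg_nonneg.2 hp.le) (ENNReal.toReal_nonneg (a := mu1 (Ioi p)))
    have := (hS_bd hs hs1 p).2
    linarith
  · rw [mu1_Ioi p hp, ENNReal.toReal_ofReal (by positivity)]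
    have h1 : p * (1 / (1 + p)) = 1 - 1 / (1 + p) := by field_simp; ring
    rw [h1]
    unfold hS
    split_ifs with h
    · rw [← ht1]; gcongr
    · exact le_rfl

lemma rev2_le {s : ℝ} (hs : 0 < s) (hs1 : s < 1) (p : ℝ) :
    p * (1 - (mu2 s (Iic p)).toReal) ≤ s * (s + hS s p) := by
  obtain ⟨ht, ht1, hv⟩ := t_facts hs hs1
  have := mu2_prob hs hs1
  rcases le_or_gt p (s / (1 - s)) with hp | hp
  · have h1 := rev1_le hs hs1 p
    rw [one_sub_cdf] at h1 ⊢
    rw [mu2_Ioi_le hs hs1 p hp]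
    simp only [hS, hp, if_true] at h1 ⊢
    linarith
  · obtain ⟨h1, h2⟩ := hv p hp.le
    have h3 : 0 < p - s := by linarith
    have h4 : 0 < 1 + p := by linarith
    rw [one_sub_cdf, mu2_Ioi_ge hs hs1 p hp.le, ENNReal.toReal_ofReal (by positivity)]
    simp only [hS, not_le.2 hp, if_false]
    have h5 : s ^ 2 / (p - s) ≤ 1 / (1 + p) := by
      rw [div_le_div_iff₀ h3 h4]; linarith
    have h6 : p * (s ^ 2 / (p - s)) = s * (s + s ^ 2 / (p - s)) := by field_simp; ring
    rw [h6]
    gcongr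

/-- For every `ε ∈ (0,1/6)`, every (possibly randomized) `m`-sample pricing strategy that
is `(1-ε)`-approximate for every regular value distribution satisfies
`m ≥ (1-6ε)² / (486 ε³)`. -/
theorem regular_sample_complexity_lower_bound (ε : ℝ) (hε : ε ∈ Ioo (0:ℝ) (1/6))
    (m : ℕ) (Ω : Type) [MeasurableSpace Ω] (P : Measure Ω)
    (hP : IsProbabilityMeasure P)
    (strat : (Fin m → ℝ) → Ω → ℝ)
    (hmeas : Measurable fun x : (Fin m → ℝ) × Ω => strat x.1 x.2)
    (happrox : ∀ D : ValueDist, D.IsRegular →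
      ∀ r : ℝ, (1 - ε) * (r * (1 - D.F r)) ≤ expRevenue D.μ P strat) :
    (1 - 6*ε) ^ 2 / (486 * ε ^ 3) ≤ (m : ℝ) := by
  obtain ⟨hε0, hε6⟩ := hε
  by_contra hcon
  rw [not_le] at hcon
  set s : ℝ := 1 - 3 * ε with hsdef
  have hs : 0 < s := by linarith
  have hs1 : s < 1 := by linarith
  obtain ⟨ht, ht1, hv⟩ := t_facts hs hs1
  have := mu2_prob hs hs1
  have hhm : Measurable fun x : (Fin m → ℝ) × Ω => hS s (strat x.1 x.2) := (hS_meas s).comp hmeas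
  have hhi : ∀ (μ : Measure ((Fin m → ℝ) × Ω)) [IsProbabilityMeasure μ],
      Integrable (fun x : (Fin m → ℝ) × Ω => hS s (strat x.1 x.2)) μ := fun μ _ =>
    Integrable.of_bound hhm.aestronglyMeasurable (1 - s)
      (Filter.Eventually.of_forall fun x => by
        rw [Real.norm_eq_abs, abs_of_nonneg (hS_bd hs hs1 _).1]; exact (hS_bd hs hs1 _).2)
  -- first distribution
  have hE1 : ∫ x, hS s (strat x.1 x.2) ∂((Measure.pi fun _ : Fin m => mu1).prod P) ≤ ε := by
    have hr : ∀ r : ℝ, 0 ≤ r → (1 - ε) * (1 - 1 / (1 + r)) ≤ expRevenue mu1 P strat := by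
      intro r hr
      have h1 := happrox D1 D1_reg r
      have h2 : 1 - D1.F r = 1 / (1 + r) := by
        have h3 : 1 - D1.F r = (mu1 (Ioi r)).toReal := one_sub_cdf mu1 r
        rw [h3, mu1_Ioi r hr, ENNReal.toReal_ofReal (by positivity)]
      rw [h2] at h1
      have h4 : r * (1 / (1 + r)) = 1 - 1 / (1 + r) := by field_simp; ring
      rw [h4] at h1
      exact h1
    have hlim : 1 - ε ≤ expRevenue mu1 P strat := by
      have hl : Filter.Tendsto (fun r : ℝ => (1 - ε) * (1 - 1 / (1 + r))) Filter.atTop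
          (nhds ((1 - ε) * (1 - 0))) := by
        apply Filter.Tendsto.const_mul
        apply Filter.Tendsto.const_sub
        exact (Filter.tendsto_atTop_add_const_left _ 1 Filter.tendsto_id).const_div_atTop 1
      have h5 := le_of_tendsto hl ((Filter.eventually_ge_atTop 0).mono hr)
      linarith
    have hint : Integrable (fun x : (Fin m → ℝ) × Ω =>
        strat x.1 x.2 * (1 - (mu1 (Iic (strat x.1 x.2))).toReal))
        ((Measure.pi fun _ : Fin m => mu1).prod P) := by
      by_contra hni
      unfold expRevenue at hlim
      rw [integral_undef hni] at hlim
      linarith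
    have hmono := integral_mono hint (g := fun x => 1 - hS s (strat x.1 x.2))
      ((integrable_const _).sub (hhi _)) (fun x => rev1_le hs hs1 _)
    rw [integral_sub (integrable_const _) (hhi _)] at hmono
    simp only [integral_const, probReal_univ, smul_eq_mul, mul_one] at hmono
    unfold expRevenue at hlim
    linarith
  -- second distribution
  have hE2 : 2 * ε ≤
      ∫ x, hS s (strat x.1 x.2) ∂((Measure.pi fun _ : Fin m => mu2 s).prod P) := by
    have hlim : (1 - ε) * s ≤ expRevenue (mu2 s) P strat := by
      have h1 := happrox (D2 hs hs1) (D2_reg hs hs1) (s / (1 - s))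
      have h2 : 1 - (D2 hs hs1).F (s / (1 - s)) = 1 - s := by
        have h3 : 1 - (D2 hs hs1).F (s / (1 - s)) = (mu2 s (Ioi (s / (1 - s)))).toReal :=
          one_sub_cdf (mu2 s) _
        rw [h3, mu2_Ioi_le hs hs1 _ le_rfl, mu1_Ioi _ ht.le, ht1,
          ENNReal.toReal_ofReal (by linarith)]
      rw [h2, div_mul_cancel₀ _ (by linarith)] at h1
      exact h1
    have hint : Integrable (fun x : (Fin m → ℝ) × Ω =>
        strat x.1 x.2 * (1 - (mu2 s (Iic (strat x.1 x.2))).toReal))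
        ((Measure.pi fun _ : Fin m => mu2 s).prod P) := by
      by_contra hni
      unfold expRevenue at hlim
      rw [integral_undef hni] at hlim
      nlinarith
    have hmono := integral_mono hint (g := fun x => s * (s + hS s (strat x.1 x.2)))
      (((integrable_const _).add (hhi _)).const_mul s) (fun x => rev2_le hs hs1 _)
    rw [integral_const_mul, integral_add (integrable_const _) (hhi _)] at hmono
    simp only [integral_const, probReal_univ, smul_eq_mul, one_mul] at hmono
    unfold expRevenue at hlim
    have h6 := hlim.trans hmono
    rw [mul_comm] at h6
    have h7 := le_of_mul_le_mul_left h6 hs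
    linarith
  have hfin := info_aux P mu1 (mu2 s) (rhoS s) (rhoS_meas s) (rhoS_nonneg s) _
    (fun v => (rhoS_le hs hs1 v).1) (mu2_eq s) _ (chi_aux hs hs1) _ hhm ε hε0
    (fun x => (hS_bd hs hs1 _).1)
    (fun x => by have := (hS_bd hs hs1 (strat x.1 x.2)).2; linarith) hE1 hE2
  set χ := (1 - s) * (2 * (1 - s) / s ^ 2) ^ 2 with hχ
  have hχ' : χ = 108 * ε ^ 3 / s ^ 4 := by
    rw [hχ, show 1 - s = 3 * ε by rw [hsdef]; ring]
    field_simp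
    ring
  have hχ0 : 0 ≤ χ := by rw [hχ']; positivity
  have hmχ : (m : ℝ) * χ ≤ 2 / 9 := by
    have h1 : (m : ℝ) * χ ≤ (1 - 6 * ε) ^ 2 / (486 * ε ^ 3) * χ :=
      mul_le_mul_of_nonneg_right hcon.le hχ0
    have h2 : (1 - 6 * ε) ^ 2 / (486 * ε ^ 3) * χ = 2 / 9 * ((1 - 6 * ε) ^ 2 / s ^ 4) := by
      rw [hχ']
      field_simp
      ring
    have h3 : (1 - 6 * ε) ^ 2 / s ^ 4 ≤ 1 := by
      rw [div_le_one (by positivity), show s ^ 4 = (s ^ 2) ^ 2 by ring]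
      apply pow_le_pow_left₀ (by linarith)
      rw [hsdef]
      nlinarith [sq_nonneg ε]
    linarith
  have hexp : (1 + χ) ^ m ≤ Real.exp (2 / 9) := by
    calc (1 + χ) ^ m ≤ (Real.exp χ) ^ m := by
          apply pow_le_pow_left₀ (by linarith)
          have := Real.add_one_le_exp χ
          linarith
      _ = Real.exp (m * χ) := (Real.exp_nat_mul χ m).symm
      _ ≤ Real.exp (2 / 9) := Real.exp_le_exp.2 hmχ
  have h8 := Real.add_one_le_exp (-(2 / 9 : ℝ))
  rw [Real.exp_neg] at h8
  have h9 : Real.exp (2 / 9) * (Real.exp (2 / 9))⁻¹ = 1 :=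
    mul_inv_cancel₀ (Real.exp_pos _).ne'
  have h10 := Real.exp_pos (2 / 9)
  nlinarith
end

section
/- There exist constants c > 0 and ε₀ ∈ (0,1) such that for every ε ∈ (0, ε₀): every (possibly randomized) m-sample pricing strategy that is (1 − ε)-approximate for every MHR value distribution satisfies m ≥ c·ε^{−3/2}. -/
open MeasureTheory Set

open scoped ENNReal


lemma lint_pi_prod {m : ℕ} (μ : Measure ℝ) [IsProbabilityMeasure μ] (g : Fin m → ℝ → ℝ≥0∞)
    (hg : ∀ i, Measurable (g i)) :
    ∫⁻ x, ∏ i, g i (x i) ∂(Measure.pi fun _ : Fin m => μ) = ∏ i, ∫⁻ y, g i y ∂μ := by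
  have hI := ProbabilityTheory.iIndepFun_pi (μ := fun _ : Fin m => μ) (X := g)
    (fun i => (hg i).aemeasurable)
  rw [ProbabilityTheory.lintegral_prod_eq_prod_lintegral_of_indepFun Finset.univ _ hI
    (fun i => (hg i).comp (measurable_pi_apply i))]
  refine Finset.prod_congr rfl fun i _ => ?_
  exact (measurePreserving_eval (fun _ : Fin m => μ) i).lintegral_comp (hg i)

lemma pi_wd {m : ℕ} (μ : Measure ℝ) [IsProbabilityMeasure μ] (l : ℝ → ℝ≥0∞)
    (hl : Measurable l) [IsProbabilityMeasure (μ.withDensity l)] :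
    (Measure.pi fun _ : Fin m => μ.withDensity l) =
      (Measure.pi fun _ : Fin m => μ).withDensity (fun x => ∏ i, l (x i)) := by
  refine Measure.pi_eq fun s hs => ?_
  rw [withDensity_apply _ (MeasurableSet.univ_pi hs), ← lintegral_indicator (MeasurableSet.univ_pi hs)]
  have : (Set.univ.pi s).indicator (fun x : Fin m → ℝ => ∏ i, l (x i))
      = fun x => ∏ i, (s i).indicator l (x i) := by
    funext x
    by_cases hx : x ∈ Set.univ.pi s
    · rw [indicator_of_mem hx]
      exact Finset.prod_congr rfl fun i _ => (indicator_of_mem (hx i (mem_univ i)) _).symm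
    · rw [indicator_of_notMem hx]
      simp only [mem_univ_pi, not_forall] at hx
      obtain ⟨i, hi⟩ := hx
      exact (Finset.prod_eq_zero (Finset.mem_univ i) (indicator_of_notMem hi _)).symm
  rw [this, lint_pi_prod μ _ (fun i => hl.indicator (hs i))]
  refine Finset.prod_congr rfl fun i _ => ?_
  rw [withDensity_apply _ (hs i), lintegral_indicator (hs i)]

/-- change of measure -/
lemma change_meas {m : ℕ} {Ω : Type} [MeasurableSpace Ω] (P : Measure Ω) [IsProbabilityMeasure P]
    (μ : Measure ℝ) [IsProbabilityMeasure μ] (l : ℝ → ℝ)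
    (hl : Measurable l) (hl0 : ∀ x, 0 ≤ l x) (ν : Measure ℝ) [IsProbabilityMeasure ν]
    (hν : ν = μ.withDensity (fun x => ENNReal.ofReal (l x)))
    (hX : (∫⁻ x, ENNReal.ofReal (l x ^ 2) ∂μ) ^ m ≤ 2)
    (A : Set ((Fin m → ℝ) × Ω)) (hA : MeasurableSet A) :
    ((Measure.pi fun _ : Fin m => ν).prod P).real A
      ≤ 1/50 + 100 * ((Measure.pi fun _ : Fin m => μ).prod P).real A := by
  subst hν
  have hlm : Measurable (fun x => ENNReal.ofReal (l x)) := hl.ennreal_ofReal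
  have hLm : Measurable (fun x : Fin m → ℝ => ∏ i, ENNReal.ofReal (l (x i))) :=
    Finset.measurable_prod _ fun i _ => hlm.comp (measurable_pi_apply i)
  have key : ((Measure.pi fun _ : Fin m => μ.withDensity (fun x => ENNReal.ofReal (l x))).prod P) A
      ≤ ENNReal.ofReal (1/100) * 2 + ENNReal.ofReal 100 * ((Measure.pi fun _ : Fin m => μ).prod P) A := by
    rw [pi_wd μ _ hlm, prod_withDensity_left hLm, withDensity_apply _ hA, ← lintegral_indicator hA]
    calc _ ≤ ∫⁻ z, (ENNReal.ofReal (1/100) * (∏ i, ENNReal.ofReal (l (z.1 i) ^ 2))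
            + A.indicator (fun _ => ENNReal.ofReal 100) z)
              ∂((Measure.pi fun _ : Fin m => μ).prod P) := by
          refine lintegral_mono fun z => ?_
          by_cases hz : z ∈ A
          · simp only [indicator_of_mem hz]
            rw [← ENNReal.ofReal_prod_of_nonneg (fun i _ => hl0 _),
              ← ENNReal.ofReal_prod_of_nonneg (fun i _ => sq_nonneg _),
              ← ENNReal.ofReal_mul (by norm_num), ← ENNReal.ofReal_add (by positivity) (by norm_num),
              Finset.prod_pow]
            refine ENNReal.ofReal_le_ofReal ?_
            nlinarith [sq_nonneg ((∏ i, l (z.1 i)) / 10 - 10), sq_nonneg (∏ i, l (z.1 i))]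
          · simp [indicator_of_notMem hz]
      _ = ENNReal.ofReal (1/100) * (∫⁻ z : (Fin m → ℝ) × Ω, (∏ i, ENNReal.ofReal (l (z.1 i) ^ 2))
              ∂((Measure.pi fun _ : Fin m => μ).prod P)) +
            ENNReal.ofReal 100 * ((Measure.pi fun _ : Fin m => μ).prod P) A := by
          rw [lintegral_add_right _ (measurable_const.indicator hA), lintegral_indicator_const hA,
            lintegral_const_mul]
          exact Finset.measurable_prod _ fun i _ => 
            ((hl.pow_const 2).ennreal_ofReal).comp ((measurable_pi_apply i).comp measurable_fst)
      _ ≤ _ := by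
          gcongr
          have h2 := (measurePreserving_fst (μ := (Measure.pi fun _ : Fin m => μ)) (ν := P)).lintegral_comp
            (f := fun x : Fin m → ℝ => ∏ i, ENNReal.ofReal (l (x i) ^ 2))
            (Finset.measurable_prod _ fun i _ => 
              ((hl.pow_const 2).ennreal_ofReal).comp (measurable_pi_apply i))
          rw [h2, lint_pi_prod μ (fun _ x => ENNReal.ofReal (l x ^ 2))
            (fun _ => (hl.pow_const 2).ennreal_ofReal)]
          simpa using hX
  have := ENNReal.toReal_mono (by finiteness) key
  rw [ENNReal.toReal_add (by finiteness) (by finiteness), ENNReal.toReal_mul, ENNReal.toReal_mul,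
    ENNReal.toReal_ofReal (by norm_num), ENNReal.toReal_ofReal (by norm_num)] at this
  simp only [Measure.real]
  norm_num at this ⊢
  linarith

noncomputable def wpos (s : ℝ) : ℝ := max 0 (1 - s)

lemma wpos_nonneg (s : ℝ) : 0 ≤ wpos s := le_max_left _ _

lemma wpos_cases (s : ℝ) : (s ≤ 1 ∧ wpos s = 1 - s) ∨ (1 ≤ s ∧ wpos s = 0) := by
  unfold wpos
  rcases le_total s 1 with h | h
  · left; exact ⟨h, max_eq_right (by linarith)⟩
  · right; exact ⟨h, max_eq_left (by linarith)⟩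

lemma wpos_cont : Continuous wpos := by unfold wpos; fun_prop

lemma wpos_deriv (n : ℕ) (s : ℝ) :
    HasDerivAt (fun s => wpos s ^ (n + 2)) (-((n : ℝ) + 2) * wpos s ^ (n + 1)) s := by
  have hl : HasDerivAt (fun s : ℝ => (1 - s) ^ (n + 2)) (-((n : ℝ) + 2) * (1 - s) ^ (n + 1)) s := by
    have := ((hasDerivAt_id s).const_sub 1).pow (n + 2)
    refine this.congr_deriv ?_
    push_cast; simp; ring
  have hEq1 : ∀ y ∈ Iic (1:ℝ), wpos y ^ (n+2) = (1 - y) ^ (n+2) := by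
    intro y hy
    rcases wpos_cases y with h | h
    · rw [h.2]
    · have : y = 1 := le_antisymm hy h.1
      rw [h.2, this]; simp
  have hEq2 : ∀ y ∈ Ici (1:ℝ), wpos y ^ (n+2) = 0 := by
    intro y hy
    rcases wpos_cases y with h | h
    · have : y = 1 := le_antisymm h.1 hy
      rw [h.2, this]; simp
    · rw [h.2]; simp
  rcases lt_trichotomy s 1 with h | h | h
  · have e : wpos s = 1 - s := by
      rcases wpos_cases s with h' | h'
      · exact h'.2
      · linarith
    rw [e]
    refine hl.congr_of_eventuallyEq ?_
    filter_upwards [Iio_mem_nhds h] with y hy using hEq1 y (mem_Iic.2 (le_of_lt (mem_Iio.1 hy)))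
  · subst h
    have e : wpos 1 = 0 := by simp [wpos]
    rw [e]
    have h1 : HasDerivWithinAt (fun s => wpos s ^ (n + 2)) (-((n : ℝ) + 2) * 0 ^ (n + 1)) (Iic 1) 1 := by
      have : HasDerivWithinAt (fun s : ℝ => (1 - s) ^ (n + 2)) (-((n : ℝ) + 2) * 0 ^ (n + 1)) (Iic 1) 1 := by
        simpa using hl.hasDerivWithinAt (s := Iic 1)
      exact this.congr hEq1 (hEq1 1 (by simp))
    have h2 : HasDerivWithinAt (fun s => wpos s ^ (n + 2)) (-((n : ℝ) + 2) * 0 ^ (n + 1)) (Ici 1) 1 := by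
      have : HasDerivWithinAt (fun s : ℝ => (0:ℝ)) (-((n : ℝ) + 2) * 0 ^ (n + 1)) (Ici 1) 1 := by
        simpa using hasDerivWithinAt_const (1:ℝ) (Ici 1) (0:ℝ)
      exact this.congr hEq2 (hEq2 1 (by simp))
    have := h1.union h2
    rwa [Iic_union_Ici, hasDerivWithinAt_univ] at this
  · have e : wpos s = 0 := by
      rcases wpos_cases s with h' | h'
      · linarith
      · exact h'.2
    rw [e]
    have : HasDerivAt (fun s : ℝ => (0:ℝ)) (-((n : ℝ) + 2) * 0 ^ (n + 1)) s := by
      simpa using hasDerivAt_const s (0:ℝ)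
    refine this.congr_of_eventuallyEq ?_
    filter_upwards [Ioi_mem_nhds h] with y hy using hEq2 y (mem_Ici.2 (le_of_lt (mem_Ioi.1 hy)))

noncomputable def psi (s : ℝ) : ℝ := s * wpos s ^ 3
noncomputable def psi1 (s : ℝ) : ℝ := (1 - 4 * s) * wpos s ^ 2
noncomputable def psi2 (s : ℝ) : ℝ := (12 * s - 6) * wpos s

lemma psi1_cont : Continuous psi1 := by
  have := wpos_cont
  unfold psi1; fun_prop

lemma psi_deriv (s : ℝ) : HasDerivAt psi (psi1 s) s := by
  have := (hasDerivAt_id s).mul (wpos_deriv 1 s)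
  refine this.congr_deriv ?_
  unfold psi1
  rcases wpos_cases s with h | h <;> rw [h.2] <;> simp <;> ring

lemma psi1_deriv (s : ℝ) : HasDerivAt psi1 (psi2 s) s := by
  have := (((hasDerivAt_id s).const_mul 4).const_sub 1).mul (wpos_deriv 0 s)
  refine this.congr_deriv ?_
  unfold psi2
  rcases wpos_cases s with h | h <;> rw [h.2] <;> simp <;> ring

lemma psi2_le (s : ℝ) : psi2 s ≤ 3/4 := by
  unfold psi2
  rcases wpos_cases s with h | h <;> rw [h.2]
  · nlinarith [sq_nonneg (4 * s - 3)]
  · norm_num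

lemma psi1_le (s : ℝ) (hs : 0 ≤ s) : psi1 s ≤ 1 := by
  unfold psi1
  rcases wpos_cases s with h | h <;> rw [h.2]
  · have : (1-s)^2 ≤ 1 := by nlinarith [h.1]
    nlinarith [sq_nonneg (1-s)]
  · norm_num

lemma psi1_sq_le (s : ℝ) (hs : 0 ≤ s) : psi1 s ^ 2 ≤ wpos s ^ 2 := by
  unfold psi1
  rcases wpos_cases s with h | h <;> rw [h.2]
  · have h1 : (1 - 4*s)*(1-s) ≤ 1 := by nlinarith [h.1]
    have h2 : -1 ≤ (1 - 4*s)*(1-s) := by nlinarith [sq_nonneg (2*s-1)]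
    have h3 : ((1 - 4*s)*(1-s))^2 ≤ 1 := by nlinarith
    nlinarith [mul_nonneg (sq_nonneg (1-s)) (sub_nonneg.2 h3)]
  · norm_num

lemma psi_nonneg (s : ℝ) (hs : 0 ≤ s) : 0 ≤ psi s :=
  mul_nonneg hs (pow_nonneg (wpos_nonneg s) 3)

lemma psi_le (s : ℝ) (hs : 0 ≤ s) : psi s ≤ s := by
  unfold psi
  have : wpos s ^ 3 ≤ 1 := pow_le_one₀ (wpos_nonneg s) (max_le (by norm_num) (by linarith))
  nlinarith

lemma psi_le' (s : ℝ) (hs : 0 ≤ s) : psi s ≤ 1/4 := by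
  unfold psi
  rcases wpos_cases s with h | h <;> rw [h.2]
  · have : (1-s)^2 ≤ 1 := by nlinarith [h.1]
    have : (1-s)^3 ≤ 1-s := by nlinarith [h.1, mul_nonneg (sub_nonneg.2 h.1) (sub_nonneg.2 this)]
    nlinarith [sq_nonneg (s - 1/2)]
  · norm_num

lemma psi_zero_of (s : ℝ) (hs : 1 ≤ s) : psi s = 0 := by
  unfold psi
  rcases wpos_cases s with h | h <;> rw [h.2]
  · have : s = 1 := le_antisymm h.1 hs
    subst this; norm_num
  · norm_num

noncomputable def GG (k η x : ℝ) : ℝ := 2 - x + k * η ^ 2 * psi ((x - 1) / η)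
noncomputable def qq (k η x : ℝ) : ℝ := 1 - k * η * psi1 ((x - 1) / η)

lemma aff_deriv (η x : ℝ) : HasDerivAt (fun x => (x - 1) / η) (1 / η) x :=
  ((hasDerivAt_id x).sub_const 1).div_const η

lemma GG_deriv (k η x : ℝ) (hη : 0 < η) : HasDerivAt (GG k η) (-qq k η x) x := by
  have h1 := (psi_deriv ((x-1)/η)).comp x (aff_deriv η x)
  have := ((hasDerivAt_id x).const_sub 2).add (h1.const_mul (k * η ^ 2))
  refine this.congr_deriv ?_
  unfold qq
  field_simp
  ring

lemma qq_deriv (k η x : ℝ) (hη : 0 < η) :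
    HasDerivAt (qq k η) (-k * psi2 ((x - 1) / η)) x := by
  have h1 := (psi1_deriv ((x-1)/η)).comp x (aff_deriv η x)
  have := ((h1.const_mul (k * η)).const_sub 1)
  refine this.congr_deriv ?_
  field_simp

lemma qq_cont (k η : ℝ) : Continuous (qq k η) := by
  have := psi1_cont
  unfold qq; fun_prop

lemma qq_ge (k η x : ℝ) (hη : 0 < η) (hη' : η ≤ 1/10) (hk : 0 ≤ k) (hk' : k ≤ 1) (hx : 1 ≤ x) :
    9/10 ≤ qq k η x := by
  have h := psi1_le ((x-1)/η) (div_nonneg (by linarith) hη.le)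
  unfold qq
  have : k * η ≤ 1/10 := by nlinarith
  have h0 : 0 ≤ k * η := by positivity
  nlinarith

lemma GG_one (k η : ℝ) : GG k η 1 = 1 := by
  unfold GG psi; norm_num

lemma GG_two (k η : ℝ) (hη : 0 < η) (hη' : η ≤ 1/10) : GG k η 2 = 0 := by
  unfold GG
  rw [psi_zero_of _ (by rw [le_div_iff₀ hη]; linarith)]; norm_num

lemma GG_nonneg (k η x : ℝ) (hη : 0 < η) (hk : 0 ≤ k) (hx : x ∈ Icc (1:ℝ) 2) :
    0 ≤ GG k η x := by
  have := psi_nonneg ((x-1)/η) (div_nonneg (by linarith [hx.1]) hη.le)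
  unfold GG
  have := mul_nonneg (mul_nonneg hk (sq_nonneg η)) this
  linarith [hx.2]

lemma GG_le (k η x : ℝ) (hη : 0 < η) (hη' : η ≤ 1/10) (hk : 0 ≤ k) (hk' : k ≤ 1)
    (hx : x ∈ Icc (1:ℝ) 2) : GG k η x ≤ 1 := by
  have h0 : 0 ≤ (x-1)/η := (div_nonneg (by linarith [hx.1]) hη.le)
  have := psi_le ((x-1)/η) h0
  unfold GG
  have h1 : x - 1 = η * ((x-1)/η) := by field_simp
  set s := (x-1)/η
  have h2 : k * η^2 * psi s ≤ k * η^2 * s := by gcongr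
  have h3 : k * η^2 * s ≤ η * s := by
    have : k * η ≤ 1 := by nlinarith
    nlinarith [mul_nonneg (mul_nonneg hη.le h0) (sub_nonneg.2 this)]
  linarith

noncomputable def ff (k η : ℝ) : ℝ → ℝ := (Icc (1:ℝ) 2).indicator (qq k η)

lemma ff_meas (k η : ℝ) : Measurable (ff k η) :=
  (qq_cont k η).measurable.indicator measurableSet_Icc

noncomputable def mm (k η : ℝ) : Measure ℝ :=
  volume.withDensity fun x => ENNReal.ofReal (ff k η x)

lemma lint_Icc (g A : ℝ → ℝ) (a b : ℝ) (hab : a ≤ b) (hg : Continuous g)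
    (h0 : ∀ x ∈ Icc a b, 0 ≤ g x)
    (hA : ∀ x, HasDerivAt A (g x) x) :
    ∫⁻ x in Icc a b, ENNReal.ofReal (g x) = ENNReal.ofReal (A b - A a) := by
  rw [← intervalIntegral.integral_eq_sub_of_hasDerivAt (fun x _ => hA x) (hg.intervalIntegrable _ _),
    intervalIntegral.integral_of_le hab, ← integral_Icc_eq_integral_Ioc,
    ofReal_integral_eq_lintegral_ofReal]
  · exact hg.continuousOn.integrableOn_Icc
  · exact (ae_restrict_mem measurableSet_Icc).mono h0

lemma mm_apply (k η : ℝ) (S : Set ℝ) (hS : MeasurableSet S) :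
    mm k η S = ∫⁻ x in S ∩ Icc 1 2, ENNReal.ofReal (qq k η x) := by
  unfold mm
  rw [withDensity_apply _ hS]
  have : (fun x => ENNReal.ofReal (ff k η x))
      = (Icc (1:ℝ) 2).indicator (fun x => ENNReal.ofReal (qq k η x)) := by
    funext x
    unfold ff
    by_cases hx : x ∈ Icc (1:ℝ) 2
    · simp only [indicator_of_mem hx]
    · simp only [indicator_of_notMem hx, ENNReal.ofReal_zero]
  rw [this, lintegral_indicator measurableSet_Icc, Measure.restrict_restrict measurableSet_Icc,
    inter_comm]

lemma mm_Icc (k η : ℝ) (hη : 0 < η) (hη' : η ≤ 1/10) (hk : 0 ≤ k) (hk' : k ≤ 1)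
    (x : ℝ) (hx : x ∈ Icc (1:ℝ) 2) :
    ∫⁻ x in Icc 1 x, ENNReal.ofReal (qq k η x) = ENNReal.ofReal (1 - GG k η x) := by
  rw [lint_Icc (qq k η) (fun x => - GG k η x) 1 x hx.1 (qq_cont k η)]
  · rw [GG_one]; ring_nf
  · intro y hy
    linarith [qq_ge k η y hη hη' hk hk' hy.1]
  · intro y
    exact (GG_deriv k η y hη).neg.congr_deriv (neg_neg _)

lemma mm_univ (k η : ℝ) (hη : 0 < η) (hη' : η ≤ 1/10) (hk : 0 ≤ k) (hk' : k ≤ 1) :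
    mm k η univ = 1 := by
  rw [mm_apply _ _ _ MeasurableSet.univ, univ_inter, mm_Icc k η hη hη' hk hk' 2 (by norm_num),
    GG_two k η hη hη']
  norm_num

lemma mm_Iic (k η : ℝ) (hη : 0 < η) (hη' : η ≤ 1/10) (hk : 0 ≤ k) (hk' : k ≤ 1)
    (x : ℝ) (hx : x ∈ Icc (1:ℝ) 2) : (mm k η (Iic x)).toReal = 1 - GG k η x := by
  have : Iic x ∩ Icc (1:ℝ) 2 = Icc 1 x := by
    ext y; simp only [mem_inter_iff, mem_Iic, mem_Icc]
    constructor
    · rintro ⟨a, b, c⟩; exact ⟨b, a⟩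
    · rintro ⟨a, b⟩; exact ⟨b, a, b.trans hx.2⟩
  rw [mm_apply _ _ _ measurableSet_Iic, this, mm_Icc k η hη hη' hk hk' x hx,
    ENNReal.toReal_ofReal]
  linarith [GG_le k η x hη hη' hk hk' hx]

noncomputable def DD (k η : ℝ) (hη : 0 < η) (hη' : η ≤ 1/10) (hk : 0 ≤ k) (hk' : k ≤ 1) :
    ValueDist where
  μ := mm k η
  isProb := ⟨mm_univ k η hη hη' hk hk'⟩
  f := ff k η
  f_nonneg := fun x => by
    refine indicator_nonneg (fun y hy => ?_) x
    linarith [qq_ge k η y hη hη' hk hk' hy.1]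
  f_meas := ff_meas k η
  density_eq := rfl
  supp := Icc 1 2
  supp_subset := fun x hx => by
    have := hx.1
    simp only [mem_Ici]; linarith
  supp_conn := ordConnected_Icc
  f_pos := fun y hy => by
    unfold ff
    rw [indicator_of_mem hy]
    linarith [qq_ge k η y hη hη' hk hk' hy.1]
  f_zero := fun x hx => indicator_of_notMem hx _

lemma DD_mhr (k η : ℝ) (hη : 0 < η) (hη' : η ≤ 1/10) (hk : 0 ≤ k) (hk' : k ≤ 1) :
    (DD k η hη hη' hk hk').IsMHR := by
  intro x hx
  have hx : x ∈ Icc (1:ℝ) 2 := hx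
  have hq := qq_ge k η x hη hη' hk hk' hx.1
  have hq0 : qq k η x ≠ 0 := by linarith
  have hd : HasDerivAt (fun x => x - GG k η x / qq k η x)
      (1 - (-qq k η x * qq k η x - GG k η x * (-k * psi2 ((x - 1) / η))) / qq k η x ^ 2) x :=
    (hasDerivAt_id x).sub ((GG_deriv k η x hη).div (qq_deriv k η x hη) hq0)
  refine ⟨_, ?_, (hd.hasDerivWithinAt (s := Icc 1 2)).congr ?_ ?_⟩
  · have hG0 := GG_nonneg k η x hη hk hx
    have hG1 := GG_le k η x hη hη' hk hk' hx
    have hp := psi2_le ((x - 1) / η)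
    have : GG k η x * (k * psi2 ((x - 1) / η)) ≤ qq k η x ^ 2 := by
      have h1 : k * psi2 ((x - 1) / η) ≤ 3/4 := by nlinarith
      have h2 : GG k η x * (k * psi2 ((x - 1) / η)) ≤ 3/4 := by nlinarith
      nlinarith
    have h3 : (-qq k η x * qq k η x - GG k η x * (-k * psi2 ((x - 1) / η))) / qq k η x ^ 2 ≤ 0 := by
      apply div_nonpos_of_nonpos_of_nonneg _ (sq_nonneg _)
      linarith
    linarith
  all_goals
    try intro x hx
    have hF : (DD k η hη hη' hk hk').F x = 1 - GG k η x := mm_Iic k η hη hη' hk hk' x hx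
    have hf : (DD k η hη hη' hk hk').f x = qq k η x := indicator_of_mem hx _
    unfold ValueDist.phi
    rw [hF, hf]
    ring

/-- revenue -/
noncomputable def rev (k η p : ℝ) : ℝ := p * (1 - (mm k η (Iic p)).toReal)

lemma rev_cases (k η : ℝ) (hη : 0 < η) (hη' : η ≤ 1/10) (hk : 0 ≤ k) (hk' : k ≤ 1) (p : ℝ) :
    (p ≤ 1 ∧ rev k η p ≤ 1) ∨ (1 ≤ p ∧ p ≤ 2 ∧ rev k η p = p * GG k η p) ∨
      (2 ≤ p ∧ rev k η p = 0) := by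
  have : IsProbabilityMeasure (mm k η) := ⟨mm_univ k η hη hη' hk hk'⟩
  rcases le_total p 1 with h | h
  · left
    refine ⟨h, ?_⟩
    unfold rev
    have h1 : (mm k η (Iic p)).toReal ≤ 1 := by
      rw [← Measure.real]; exact measureReal_le_one
    have h0 : 0 ≤ (mm k η (Iic p)).toReal := ENNReal.toReal_nonneg
    nlinarith
  right
  rcases le_total p 2 with h2 | h2
  · left
    refine ⟨h, h2, ?_⟩
    unfold rev
    rw [mm_Iic k η hη hη' hk hk' p ⟨h, h2⟩]; ring
  · right
    refine ⟨h2, ?_⟩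
    have h1 : (mm k η (Iic p)).toReal ≤ 1 := by
      rw [← Measure.real]; exact measureReal_le_one
    have h3 : (mm k η (Iic 2)).toReal = 1 := by
      rw [mm_Iic k η hη hη' hk hk' 2 (by norm_num), GG_two k η hη hη']; norm_num
    have h4 : (mm k η (Iic 2)).toReal ≤ (mm k η (Iic p)).toReal :=
      ENNReal.toReal_mono (measure_ne_top _ _) (measure_mono (Iic_subset_Iic.2 h2))
    unfold rev
    rw [show (mm k η (Iic p)).toReal = 1 by linarith]; ring

lemma rev0_le (η : ℝ) (hη : 0 < η) (hη' : η ≤ 1/10) (p : ℝ) : rev 0 η p ≤ 1 := by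
  rcases rev_cases 0 η hη hη' le_rfl zero_le_one p with h | h | h
  · exact h.2
  · rw [h.2.2]; unfold GG; nlinarith [sq_nonneg (p - 1)]
  · rw [h.2]; norm_num

lemma rev0_le' (η : ℝ) (hη : 0 < η) (hη' : η ≤ 1/10) (p : ℝ) (hp : 1 + 3/100 * η < p) :
    rev 0 η p ≤ 1 - 9/10000 * η ^ 2 := by
  rcases rev_cases 0 η hη hη' le_rfl zero_le_one p with h | h | h
  · nlinarith
  · rw [h.2.2]; unfold GG; nlinarith
  · rw [h.2]; nlinarith

lemma rev1_form (η p : ℝ) (hη : 0 < η) :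
    p * GG 1 η p = 1 - η^2 * ((p-1)/η)^2 + η^2 * psi ((p-1)/η) * (1 + η * ((p-1)/η)) := by
  have h1 : p = 1 + η * ((p-1)/η) := by field_simp; ring
  unfold GG
  set s := (p-1)/η
  rw [h1]; ring

lemma rev1_le_s14 (η : ℝ) (hη : 0 < η) (hη' : η ≤ 1/10) (p : ℝ) : rev 1 η p ≤ 1 + 3/10 * η ^ 2 := by
  rcases rev_cases 1 η hη hη' zero_le_one le_rfl p with h | h | h
  · nlinarith [h.2]
  · rw [h.2.2, rev1_form η p hη]
    have h0 : 0 ≤ (p-1)/η := (div_nonneg (by linarith [h.1]) hη.le)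
    set s := (p-1)/η
    suffices psi s * (1 + η * s) ≤ 3/10 by nlinarith [sq_nonneg s, sq_nonneg η, mul_nonneg (sq_nonneg η) (sub_nonneg.2 this), mul_nonneg (sq_nonneg η) (sq_nonneg s)]
    rcases le_total s 1 with h1 | h1
    · have := psi_le' s h0
      have h3 : 1 + η * s ≤ 11/10 := by nlinarith
      have := psi_nonneg s h0
      nlinarith
    · rw [psi_zero_of s h1]; norm_num
  · rw [h.2]; nlinarith

lemma rev1_le' (η : ℝ) (hη : 0 < η) (hη' : η ≤ 1/10) (p : ℝ) (hp : p ≤ 1 + 3/100 * η) :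
    rev 1 η p ≤ 1 + 31/1000 * η ^ 2 := by
  rcases rev_cases 1 η hη hη' zero_le_one le_rfl p with h | h | h
  · nlinarith [h.2]
  · rw [h.2.2, rev1_form η p hη]
    have h0 : 0 ≤ (p-1)/η := (div_nonneg (by linarith [h.1]) hη.le)
    have h2 : (p-1)/η ≤ 3/100 := by rw [div_le_iff₀ hη]; linarith
    set s := (p-1)/η
    suffices psi s * (1 + η * s) ≤ 31/1000 by nlinarith [mul_nonneg (sq_nonneg η) (sub_nonneg.2 this), mul_nonneg (sq_nonneg η) (sq_nonneg s)]
    have h4 := psi_le s h0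
    have h3 : 1 + η * s ≤ 1003/1000 := by nlinarith
    have := psi_nonneg s h0
    nlinarith
  · rw [h.2]; nlinarith

lemma rev1_opt (η : ℝ) (hη : 0 < η) (hη' : η ≤ 1/10) :
    1 + 62/1000 * η ^ 2 ≤ rev 1 η (1 + η / 5) := by
  have hr : rev 1 η (1 + η / 5) = (1 + η / 5) * GG 1 η (1 + η / 5) := by
    unfold rev
    rw [mm_Iic 1 η hη hη' zero_le_one le_rfl _ ⟨by linarith, by linarith⟩]; ring
  have e : (1 + η/5 - 1) / η = 1/5 := by field_simp; ring
  rw [hr, rev1_form _ _ hη, e]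
  have : psi (1/5) = 64/625 := by unfold psi wpos; norm_num
  rw [this]
  nlinarith [sq_nonneg η, mul_nonneg (sq_nonneg η) hη.le]

lemma rev0_opt (η : ℝ) (hη : 0 < η) (hη' : η ≤ 1/10) : rev 0 η 1 = 1 := by
  unfold rev
  rw [mm_Iic 0 η hη hη' le_rfl zero_le_one _ (by norm_num), GG_one]; norm_num

lemma mm_rel (η : ℝ) :
    mm 1 η = (mm 0 η).withDensity (fun x => ENNReal.ofReal (ff 1 η x)) := by
  unfold mm
  rw [← withDensity_mul _ (ff_meas 0 η).ennreal_ofReal (ff_meas 1 η).ennreal_ofReal]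
  congr 1
  funext x
  simp only [Pi.mul_apply]
  unfold ff
  by_cases hx : x ∈ Icc (1:ℝ) 2
  · simp only [indicator_of_mem hx]
    simp [qq]
  · simp only [indicator_of_notMem hx]; simp

lemma chi_sq (η : ℝ) (hη : 0 < η) (hη' : η ≤ 1/10) :
    ∫⁻ x, ENNReal.ofReal (ff 1 η x ^ 2) ∂(mm 0 η) ≤ ENNReal.ofReal (1 + η ^ 3) := by
  unfold mm
  rw [lintegral_withDensity_eq_lintegral_mul _ (ff_meas 0 η).ennreal_ofReal
    ((ff_meas 1 η).pow_const 2).ennreal_ofReal]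
  have hw := wpos_cont
  have hp := psi1_cont
  set g : ℝ → ℝ := fun x => 1 - 2 * η * psi1 ((x-1)/η) + η^2 * wpos ((x-1)/η)^2 with hg
  have hle : ∀ x ∈ Icc (1:ℝ) 2, qq 1 η x ^ 2 ≤ g x := by
    intro x hx
    have h0 : 0 ≤ (x-1)/η := (div_nonneg (by linarith [hx.1]) hη.le)
    have := psi1_sq_le _ h0
    simp only [hg, qq]
    nlinarith [mul_nonneg (sq_nonneg η) (sub_nonneg.2 this)]
  calc _ ≤ ∫⁻ x, (Icc (1:ℝ) 2).indicator (fun x => ENNReal.ofReal (g x)) x := by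
        refine lintegral_mono fun x => ?_
        simp only [Pi.mul_apply]
        unfold ff
        by_cases hx : x ∈ Icc (1:ℝ) 2
        · simp only [indicator_of_mem hx]
          have : qq 0 η x = 1 := by simp [qq]
          rw [this, ENNReal.ofReal_one, one_mul]
          exact ENNReal.ofReal_le_ofReal (hle x hx)
        · simp only [indicator_of_notMem hx]; simp
    _ = ∫⁻ x in Icc (1:ℝ) 2, ENNReal.ofReal (g x) := lintegral_indicator measurableSet_Icc _
    _ = _ := lint_Icc g (fun x => x - 2 * η^2 * psi ((x-1)/η) - η^3/3 * wpos ((x-1)/η)^3) 1 2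
        (by norm_num) (by simp only [hg]; fun_prop)
        (fun x hx => (sq_nonneg _).trans (hle x hx)) (fun x => by
          have h1 := (psi_deriv ((x-1)/η)).comp x (aff_deriv η x)
          have h2 := (wpos_deriv 1 ((x-1)/η)).comp x (aff_deriv η x)
          have := ((hasDerivAt_id x).sub (h1.const_mul (2*η^2))).sub (h2.const_mul (η^3/3))
          refine this.congr_deriv ?_
          simp only [hg]
          field_simp
          push_cast
          ring)
    _ ≤ _ := by
        refine ENNReal.ofReal_le_ofReal ?_
        have h1 : (1:ℝ) ≤ (2-1)/η := by rw [le_div_iff₀ hη]; linarith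
        rw [psi_zero_of _ h1]
        have h2 := wpos_nonneg ((2-1)/η)
        have h3 : wpos ((1-1)/η) = 1 := by simp [wpos]
        have h4 : psi ((1-1)/η) = 0 := by simp [psi]
        have h5 : 0 ≤ η^3/3 * wpos ((2-1)/η)^3 := by positivity
        rw [h3, h4]
        have : 0 < η^3 := by positivity
        linarith

lemma int_bound {X : Type} [MeasurableSpace X] (ρ : Measure X) [IsProbabilityMeasure ρ]
    (g : X → ℝ) (A : Set X) (hA : MeasurableSet A) (a b v : ℝ) (hv : 0 < v)
    (h : v ≤ ∫ x, g x ∂ρ) (h1 : ∀ x ∈ A, g x ≤ a + b) (h2 : ∀ x ∉ A, g x ≤ a) :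
    v ≤ a + b * ρ.real A := by
  have hi : Integrable g ρ := by
    by_contra hc
    rw [integral_undef hc] at h
    linarith
  refine h.trans ?_
  have hib : Integrable (A.indicator fun _ => b) ρ := (integrable_const b).indicator hA
  calc ∫ x, g x ∂ρ ≤ ∫ x, (a + A.indicator (fun _ => b) x) ∂ρ := by
        refine integral_mono hi ((integrable_const a).add hib) fun x => ?_
        by_cases hx : x ∈ A
        · simpa [indicator_of_mem hx] using h1 x hx
        · simpa [indicator_of_notMem hx] using h2 x hx
    _ = _ := by
        rw [integral_add (integrable_const a) hib, integral_indicator_const b hA]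
        simp [mul_comm]

/-- There are constants `c > 0` and `ε₀ ∈ (0,1)` such that for every `ε ∈ (0,ε₀)`, every
(possibly randomized) `m`-sample pricing strategy that is `(1-ε)`-approximate for every
MHR value distribution satisfies `m ≥ c ε^{-3/2}`. -/
theorem mhr_sample_complexity_lower_bound :
    ∃ c ε₀ : ℝ, 0 < c ∧ ε₀ ∈ Ioo (0:ℝ) 1 ∧
      ∀ ε : ℝ, ε ∈ Ioo (0:ℝ) ε₀ →
      ∀ (m : ℕ) (Ω : Type) [MeasurableSpace Ω] (P : Measure Ω),
        IsProbabilityMeasure P →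
      ∀ strat : (Fin m → ℝ) → Ω → ℝ,
        (Measurable fun x : (Fin m → ℝ) × Ω => strat x.1 x.2) →
        (∀ D : ValueDist, D.IsMHR →
          ∀ r : ℝ, (1 - ε) * (r * (1 - D.F r)) ≤ expRevenue D.μ P strat) →
        c * ε ^ (-(3:ℝ)/2) ≤ (m : ℝ) := by
  refine ⟨1/10^13, 1/10^10, by norm_num, by norm_num, ?_⟩
  intro ε hε m Ω _ P hP strat hmeas happ
  obtain ⟨hε0, hε1⟩ := hε
  by_contra hm
  rw [not_le] at hm
  set t := Real.sqrt ε with ht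
  have ht0 : 0 < t := Real.sqrt_pos.2 hε0
  have ht2 : t ^ 2 = ε := Real.sq_sqrt hε0.le
  obtain ⟨η, hηdef⟩ : ∃ η : ℝ, η = 10^4 * t := ⟨_, rfl⟩
  have hη : 0 < η := by rw [hηdef]; positivity
  have hη2 : η ^ 2 = 10^8 * ε := by rw [hηdef, mul_pow, ht2]; norm_num
  have hη' : η ≤ 1/10 := by
    have : η ^ 2 ≤ (1/10)^2 := by rw [hη2]; norm_num at hε1 ⊢; linarith
    exact le_of_sq_le_sq this (by norm_num)
  have hm3 : (m : ℝ) * η ^ 3 ≤ 1/2 := by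
    have h1 : ε ^ (-(3:ℝ)/2) * t ^ 3 = 1 := by
      have : t ^ 3 = ε ^ ((3:ℝ)/2) := by
        rw [ht, Real.sqrt_eq_rpow, ← Real.rpow_natCast, ← Real.rpow_mul hε0.le]
        norm_num
      rw [this, ← Real.rpow_add hε0]
      norm_num
    have h3 : η ^ 3 = 10^12 * t^3 := by rw [hηdef]; ring
    have ht3 : 0 < t ^ 3 := by positivity
    rw [h3]
    have := mul_le_mul_of_nonneg_right hm.le ht3.le
    rw [mul_assoc, h1] at this
    nlinarith
  have p0 : IsProbabilityMeasure (mm 0 η) := ⟨mm_univ 0 η hη hη' le_rfl zero_le_one⟩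
  have p1 : IsProbabilityMeasure (mm 1 η) := ⟨mm_univ 1 η hη hη' zero_le_one le_rfl⟩
  have hX : (∫⁻ x, ENNReal.ofReal (ff 1 η x ^ 2) ∂(mm 0 η)) ^ m ≤ 2 := by
    calc _ ≤ (ENNReal.ofReal (1 + η ^ 3)) ^ m := by
          gcongr
          exact chi_sq η hη hη'
      _ = ENNReal.ofReal ((1 + η ^ 3) ^ m) := by
          rw [ENNReal.ofReal_pow (by positivity)]
      _ ≤ ENNReal.ofReal 2 := by
          refine ENNReal.ofReal_le_ofReal ?_
          have h1 : (1 + η ^ 3) ^ m ≤ Real.exp (η ^ 3) ^ m := by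
            gcongr
            linarith [Real.add_one_le_exp (η ^ 3)]
          rw [← Real.exp_nat_mul] at h1
          have h2 : Real.exp (m * η ^ 3) ≤ Real.exp (1/2) := Real.exp_le_exp.2 hm3
          have h3 : Real.exp (1/2) ^ 2 ≤ 2 ^ 2 := by
            rw [← Real.exp_nat_mul]
            have := Real.exp_one_lt_d9
            norm_num at this ⊢
            linarith
          have h4 : Real.exp (1/2) ≤ 2 := le_of_sq_le_sq h3 (by norm_num)
          linarith
      _ = 2 := by simp
  set A : Set ((Fin m → ℝ) × Ω) := {z | 1 + 3/100 * η < strat z.1 z.2} with hAdef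
  have hA : MeasurableSet A := measurableSet_lt measurable_const hmeas
  have hf0 : ∀ x, 0 ≤ ff 1 η x := (DD 1 η hη hη' zero_le_one le_rfl).f_nonneg
  have hC := change_meas P (mm 0 η) (ff 1 η) (ff_meas 1 η) hf0 (mm 1 η) (mm_rel η) hX A hA
  have hE0 : (1 - ε) * rev 0 η 1 ≤ ∫ z, rev 0 η (strat z.1 z.2)
      ∂((Measure.pi fun _ : Fin m => mm 0 η).prod P) :=
    happ _ (DD_mhr 0 η hη hη' le_rfl zero_le_one) 1
  have hE1 : (1 - ε) * rev 1 η (1 + η/5) ≤ ∫ z, rev 1 η (strat z.1 z.2)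
      ∂((Measure.pi fun _ : Fin m => mm 1 η).prod P) :=
    happ _ (DD_mhr 1 η hη hη' zero_le_one le_rfl) (1 + η/5)
  have hε' : ε < 1/1000 := hε1.trans (by norm_num)
  have hB0 := int_bound _ _ A hA 1 (-(9/10000 * η^2)) (1 - ε) (by linarith)
    (by rw [rev0_opt η hη hη', mul_one] at hE0; exact hE0)
    (fun z hz => by linarith [rev0_le' η hη hη' _ hz])
    (fun z _ => rev0_le η hη hη' _)
  have hopt := rev1_opt η hη hη'
  have hB1 := int_bound _ _ A hA (1 + 31/1000 * η^2) (269/1000 * η^2)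
    ((1 - ε) * (1 + 62/1000 * η ^ 2)) (mul_pos (by linarith) (by positivity))
    ((mul_le_mul_of_nonneg_left hopt (by linarith)).trans hE1)
    (fun z _ => by linarith [rev1_le_s14 η hη hη' (strat z.1 z.2)])
    (fun z hz => rev1_le' η hη hη' _ (not_lt.1 hz))
  set a := ((Measure.pi fun _ : Fin m => mm 0 η).prod P).real A
  set b := ((Measure.pi fun _ : Fin m => mm 1 η).prod P).real A
  rw [hη2] at hB0 hB1
  have ha : a ≤ 1/90000 := by
    have : ε * (90000 * a) ≤ ε * 1 := by nlinarith
    have := le_of_mul_le_mul_left this hε0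
    linarith
  have hb : 1/10 ≤ b := by
    have : ε * (62/1000 * 10^8 - 31/1000*10^8 - 1 - ε * (62/1000*10^8)) ≤ ε * (269/1000*10^8 * b) := by
      nlinarith
    have := le_of_mul_le_mul_left this hε0
    nlinarith
  linarith
end
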